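/- Let Λ be a set with |Λ| ≥ 4, F a field, and K, Q : Λ² → F determinantally equivalent functions of class D. Then for every 4-element subset M ⊆ Λ, either every 3-cycle of distinct vertices in M belongs to Case 1, or every 3-cycle of distinct vertices in M belongs to Case 2. -/

import Mathlib

def DetEquiv {Λ F : Type*} [Field F] (K Q : Λ → Λ → F) : Prop :=
  ∀ (n : ℕ) (x : Fin n → Λ),
    Matrix.det (Matrix.of fun i j => K (x i) (x j)) =
    Matrix.det (Matrix.of fun i j => Q (x i) (x j))

def ClassD {Λ F : Type*} [Field F] (h : Λ → Λ → F) : Prop :=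
  ∀ x y z w : Λ, x ≠ y → x ≠ z → x ≠ w → y ≠ z → y ≠ w → z ≠ w →
    h x y * h w z - h x z * h w y ≠ 0

/-- The products of `K` along both orientations of the triangle `a b c` agree with those of `Q`. -/
def TriangleEq {Λ F : Type*} [Field F] (K Q : Λ → Λ → F) (a b c : Λ) : Prop :=
  K a b * K b c * K c a = Q a b * Q b c * Q c a ∧
    K b a * K c b * K a c = Q b a * Q c b * Q a c

section

variable {Λ F : Type*} [Field F] {K Q : Λ → Λ → F}

theorem DetEquiv.symm (h : DetEquiv K Q) : DetEquiv Q K := fun n x => (h n x).symm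

theorem DetEquiv.flip_right (h : DetEquiv K Q) : DetEquiv K (flip Q) := fun n x =>
  (h n x).trans (Matrix.det_transpose _).symm

theorem ClassD.flip (h : ClassD K) : ClassD (flip K) := by
  intro x y z w h1 h2 h3 h4 h5 h6 h0
  refine h y x w z h1.symm h5 h4 h3 h2 h6.symm ?_
  simp only [_root_.flip] at h0
  linear_combination h0

theorem DetEquiv.diag (h : DetEquiv K Q) (a : Λ) : K a a = Q a a := by
  simpa using h 1 ![a]

theorem DetEquiv.edge (h : DetEquiv K Q) (a b : Λ) : K a b * K b a = Q a b * Q b a := by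
  have := h 2 ![a, b]
  simp [Matrix.det_fin_two, h.diag] at this
  exact this

theorem DetEquiv.triangle_add (h : DetEquiv K Q) (a b c : Λ) :
    K a b * K b c * K c a + K b a * K c b * K a c =
      Q a b * Q b c * Q c a + Q b a * Q c b * Q a c := by
  have := h 3 ![a, b, c]
  simp [Matrix.det_fin_three, h.diag] at this
  linear_combination this + Q a a * h.edge b c + Q b b * h.edge a c + Q c c * h.edge a b

theorem DetEquiv.quad_add (h : DetEquiv K Q) (a b c d : Λ) :
    K a b * K b c * K c d * K d a + K b a * K c b * K d c * K a d +
    (K a c * K c b * K b d * K d a + K c a * K b c * K d b * K a d) +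
    (K a b * K b d * K d c * K c a + K b a * K d b * K c d * K a c) =
    Q a b * Q b c * Q c d * Q d a + Q b a * Q c b * Q d c * Q a d +
    (Q a c * Q c b * Q b d * Q d a + Q c a * Q b c * Q d b * Q a d) +
    (Q a b * Q b d * Q d c * Q c a + Q b a * Q d b * Q c d * Q a c) := by
  have := h 4 ![a, b, c, d]
  simp [Matrix.det_succ_row_zero, Fin.sum_univ_succ, Fin.succAbove, h.diag] at this
  have eab := h.edge a b
  have eac := h.edge a c
  have ead := h.edge a d
  have ebc := h.edge b c
  have ebd := h.edge b d
  have ecd := h.edge c d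
  have := h.triangle_add a b c
  have := h.triangle_add a b d
  have := h.triangle_add a c d
  have := h.triangle_add b c d
  grind

theorem DetEquiv.triangleEq_or (h : DetEquiv K Q) (a b c : Λ) :
    TriangleEq K Q a b c ∨ TriangleEq K (flip Q) a b c := by
  have hs := h.triangle_add a b c
  have hp : (K a b * K b c * K c a) * (K b a * K c b * K a c) =
      (Q a b * Q b c * Q c a) * (Q b a * Q c b * Q a c) := by
    linear_combination (K b c * K c b * K a c * K c a) * h.edge a b +
      (Q a b * Q b a * K a c * K c a) * h.edge b c + (Q a b * Q b a * Q b c * Q c b) * h.edge a c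
  have : (K a b * K b c * K c a - Q a b * Q b c * Q c a) *
      (K a b * K b c * K c a - Q b a * Q c b * Q a c) = 0 := by
    linear_combination (K a b * K b c * K c a) * hs - hp
  rcases mul_eq_zero.1 this with h0 | h0
  · exact Or.inl ⟨by linear_combination h0, by linear_combination hs - h0⟩
  · exact Or.inr ⟨by simp only [flip]; linear_combination h0,
      by simp only [flip]; linear_combination hs - h0⟩

theorem edge_ne_zero (h : DetEquiv K Q) {a b c d : Λ}
    (hp : TriangleEq K Q a b c) (hp' : K a b * K b c * K c a ≠ K b a * K c b * K a c)
    (hr : TriangleEq K (flip Q) a b d) (hr' : K a b * K b d * K d a ≠ K b a * K d b * K a d) :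
    K a b ≠ 0 ∧ K b a ≠ 0 := by
  obtain ⟨p1, p2⟩ := hp
  obtain ⟨r1, r2⟩ := hr
  have := h.edge a b
  simp only [flip] at r1 r2
  grind

theorem TriangleEq.rotate {a b c : Λ} (h : TriangleEq K Q a b c) : TriangleEq K Q b c a :=
  ⟨by linear_combination h.1, by linear_combination h.2⟩

theorem TriangleEq.swap {a b c : Λ} (h : TriangleEq K Q a b c) : TriangleEq K Q b a c :=
  ⟨by linear_combination h.2, by linear_combination h.1⟩

theorem TriangleEq.swap_right {a b c : Λ} (h : TriangleEq K Q a b c) : TriangleEq K Q a c b :=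
  h.rotate.swap.rotate.rotate

theorem opposite_edge_eq_zero (h : DetEquiv K Q) {a b c d : Λ}
    (hp : TriangleEq K Q a b c) (hp' : K a b * K b c * K c a ≠ K b a * K c b * K a c)
    (hr : TriangleEq K (flip Q) a b d) (hr' : K a b * K b d * K d a ≠ K b a * K d b * K a d)
    (ht : TriangleEq K Q a c d) (hu : TriangleEq K Q b c d) : K c d * K d c = 0 := by
  obtain ⟨p1, p2⟩ := hp
  obtain ⟨r1, r2⟩ := hr
  obtain ⟨t1, t2⟩ := ht
  obtain ⟨u1, u2⟩ := hu
  simp only [flip] at r1 r2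
  have eab := h.edge a b
  have ecd := h.edge c d
  have e1 : (K c d * K d c) * (K b a * K c b * K a c) *
      (K a b * K b d * K d a - K b a * K d b * K a d) = 0 := by
    have e2 : (Q c d * Q d c) * (Q b a * Q c b * Q a c) * (Q a b * Q b d * Q d a) =
      (Q a b * Q b a) * (Q a c * Q c d * Q d a) * (Q c b * Q d c * Q b d) := by ring
    rw [← ecd, ← eab, ← p2, ← r2, ← t1, ← u2] at e2
    linear_combination -e2
  have e1' : (K c d * K d c) * (K a b * K b c * K c a) *
      (K a b * K b d * K d a - K b a * K d b * K a d) = 0 := by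
    have e2 : (Q c d * Q d c) * (Q a b * Q b c * Q c a) * (Q b a * Q d b * Q a d) =
      (Q a b * Q b a) * (Q c a * Q d c * Q a d) * (Q b c * Q c d * Q d b) := by ring
    rw [← ecd, ← eab, ← p1, ← r1, ← t2, ← u1] at e2
    linear_combination e2
  by_contra h0
  have e1 := (mul_eq_zero.1 e1).resolve_right (sub_ne_zero.2 hr')
  have e1' := (mul_eq_zero.1 e1').resolve_right (sub_ne_zero.2 hr')
  exact hp' (((mul_eq_zero.1 e1').resolve_left h0).trans ((mul_eq_zero.1 e1).resolve_left h0).symm)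

theorem edge_ne_zero_of_same_same (h : DetEquiv K Q) (hK : ClassD K) (hQ : ClassD Q) {a b c d : Λ}
    (nab : a ≠ b) (nac : a ≠ c) (nad : a ≠ d) (nbc : b ≠ c) (nbd : b ≠ d) (ncd : c ≠ d)
    (hp : TriangleEq K Q a b c) (hp' : K a b * K b c * K c a ≠ K b a * K c b * K a c)
    (hr : TriangleEq K (flip Q) a b d) (hr' : K a b * K b d * K d a ≠ K b a * K d b * K a d)
    (ht : TriangleEq K Q a c d) (hu : TriangleEq K Q b c d) : K a c ≠ 0 := by
  intro h0
  have hcd := opposite_edge_eq_zero h hp hp' hr hr' ht hu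
  obtain ⟨kab, kba⟩ := edge_ne_zero h hp hp' hr hr'
  obtain ⟨p1, p2⟩ := hp
  obtain ⟨r1, r2⟩ := hr
  obtain ⟨t1, t2⟩ := ht
  obtain ⟨u1, u2⟩ := hu
  simp only [flip] at r1 r2
  have eab := h.edge a b
  have eac := h.edge a c
  have ead := h.edge a d
  have ebc := h.edge b c
  have ebd := h.edge b d
  have ecd := h.edge c d
  have kp : K a b * K b c * K c a ≠ 0 := by grind
  have kca : K c a ≠ 0 := by grind
  have kbc : K b c ≠ 0 := by grind
  have qca : Q c a ≠ 0 := by grind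
  have qac : Q a c = 0 := by grind
  have kad : K a d ≠ 0 := by have := hK a d c b; grind
  have kdc : K d c ≠ 0 := by have := hK a c b d; grind
  have kcd : K c d = 0 := by grind
  have kcb : K c b ≠ 0 := by have := hK c d b a; grind
  have qdc : Q d c ≠ 0 := by have := hQ a c b d; grind
  have qcd : Q c d = 0 := by grind
  have e3 : K a b * K b d * K d c * K c a = Q a b * Q b d * Q d c * Q c a := by
    have e2 : (Q a b * Q b d * Q d c * Q c a) * (Q b c * Q c b) =
      (Q a b * Q b c * Q c a) * (Q c b * Q d c * Q b d) := by ring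
    rw [← ebc, ← p1, ← u2] at e2
    have : K b c * K c b ≠ 0 := mul_ne_zero kbc kcb
    apply mul_right_cancel₀ this
    linear_combination -e2
  have e4 : (Q a b * Q b d * Q d c * Q c a) * (Q a d * Q d a) =
      (Q a b * Q b d * Q d a) * (Q c a * Q d c * Q a d) := by ring
  rw [← e3, ← ead, ← r2, ← t2] at e4
  have : (K c a * K d c * K a d) *
      (K a b * K b d * K d a - K b a * K d b * K a d) = 0 := by
    linear_combination e4
  grind

theorem edge_product_ne_zero_of_same_same (h : DetEquiv K Q) (hK : ClassD K) (hQ : ClassD Q)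
    {a b c d : Λ}
    (nab : a ≠ b) (nac : a ≠ c) (nad : a ≠ d) (nbc : b ≠ c) (nbd : b ≠ d) (ncd : c ≠ d)
    (hp : TriangleEq K Q a b c) (hp' : K a b * K b c * K c a ≠ K b a * K c b * K a c)
    (hr : TriangleEq K (flip Q) a b d) (hr' : K a b * K b d * K d a ≠ K b a * K d b * K a d)
    (ht : TriangleEq K Q a c d) (hu : TriangleEq K Q b c d) : K a c * K c a ≠ 0 := by
  intro h0
  rcases mul_eq_zero.1 h0 with h0 | h0
  · exact edge_ne_zero_of_same_same h hK hQ nab nac nad nbc nbd ncd hp hp' hr hr' ht hu h0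
  · exact edge_ne_zero_of_same_same (K := flip K) (Q := flip Q) h.symm.flip_right.symm.flip_right
      hK.flip hQ.flip nab nac nad nbc nbd ncd hp.symm hp'.symm hr.symm hr'.symm ht.symm hu.symm h0

theorem not_same_same (h : DetEquiv K Q) (hK : ClassD K) (hQ : ClassD Q) {a b c d : Λ}
    (nab : a ≠ b) (nac : a ≠ c) (nad : a ≠ d) (nbc : b ≠ c) (nbd : b ≠ d) (ncd : c ≠ d)
    (hp : TriangleEq K Q a b c) (hp' : K a b * K b c * K c a ≠ K b a * K c b * K a c)
    (hr : TriangleEq K (flip Q) a b d) (hr' : K a b * K b d * K d a ≠ K b a * K d b * K a d)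
    (ht : TriangleEq K Q a c d) (hu : TriangleEq K Q b c d) : False := by
  have hac : K a c * K c a ≠ 0 :=
    edge_product_ne_zero_of_same_same h hK hQ nab nac nad nbc nbd ncd hp hp' hr hr' ht hu
  have hbc : K b c * K c b ≠ 0 :=
    edge_product_ne_zero_of_same_same h hK hQ nab.symm nbc nbd nac nad ncd hp.swap (by grind)
      hr.swap (by grind) hu ht
  obtain ⟨kab, kba⟩ := edge_ne_zero h hp hp' hr hr'
  have hq := h.quad_add a b c d
  have eab := h.edge a b
  have eac := h.edge a c
  have ebc := h.edge b c
  obtain ⟨p1, p2⟩ := hp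
  obtain ⟨r1, r2⟩ := hr
  obtain ⟨t1, t2⟩ := ht
  obtain ⟨u1, u2⟩ := hu
  simp only [flip] at r1 r2
  have c1 : (Q a b * Q b c * Q c d * Q d a) * (Q a c * Q c a) =
      (Q a b * Q b c * Q c a) * (Q a c * Q c d * Q d a) := by ring
  have c1' : (Q b a * Q c b * Q d c * Q a d) * (Q a c * Q c a) =
      (Q b a * Q c b * Q a c) * (Q c a * Q d c * Q a d) := by ring
  have c3 : (Q a b * Q b d * Q d c * Q c a) * (Q b c * Q c b) =
      (Q a b * Q b c * Q c a) * (Q c b * Q d c * Q b d) := by ring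
  have c3' : (Q b a * Q d b * Q c d * Q a c) * (Q b c * Q c b) =
      (Q b a * Q c b * Q a c) * (Q b c * Q c d * Q d b) := by ring
  have c2 : (Q a c * Q c b * Q b d * Q d a) * (Q a b * Q b a) =
      (Q b a * Q c b * Q a c) * (Q a b * Q b d * Q d a) := by ring
  have c2' : (Q c a * Q b c * Q d b * Q a d) * (Q a b * Q b a) =
      (Q a b * Q b c * Q c a) * (Q b a * Q d b * Q a d) := by ring
  rw [← eac, ← p1, ← t1] at c1
  rw [← eac, ← p2, ← t2] at c1'
  rw [← ebc, ← p1, ← u2] at c3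
  rw [← ebc, ← p2, ← u1] at c3'
  rw [← eab, ← p1, ← r1] at c2'
  rw [← eab, ← p2, ← r2] at c2
  have d1 : K a b * K b c * K c d * K d a = Q a b * Q b c * Q c d * Q d a :=
    mul_right_cancel₀ hac (by linear_combination -c1)
  have d1' : K b a * K c b * K d c * K a d = Q b a * Q c b * Q d c * Q a d :=
    mul_right_cancel₀ hac (by linear_combination -c1')
  have d3 : K a b * K b d * K d c * K c a = Q a b * Q b d * Q d c * Q c a :=
    mul_right_cancel₀ hbc (by linear_combination -c3)
  have d3' : K b a * K d b * K c d * K a c = Q b a * Q d b * Q c d * Q a c :=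
    mul_right_cancel₀ hbc (by linear_combination -c3')
  have : (K a b * K b c * K c a - K b a * K c b * K a c) *
      (K a b * K b d * K d a - K b a * K d b * K a d) = 0 := by
    linear_combination (-K a b * K b a) * (hq - d1 - d1' - d3 - d3') - c2 - c2'
  exact (mul_ne_zero (sub_ne_zero.2 hp') (sub_ne_zero.2 hr')) this

theorem edge_eq_zero_of_same_flip (h : DetEquiv K Q) (hK : ClassD K) {a b c d : Λ}
    (nab : a ≠ b) (nac : a ≠ c) (nad : a ≠ d) (nbc : b ≠ c) (nbd : b ≠ d) (ncd : c ≠ d)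
    (hp : TriangleEq K Q a b c) (hp' : K a b * K b c * K c a ≠ K b a * K c b * K a c)
    (hr : TriangleEq K (flip Q) a b d) (hr' : K a b * K b d * K d a ≠ K b a * K d b * K a d)
    (ht : TriangleEq K Q a c d)
    (hu : TriangleEq K (flip Q) b c d)
    (hbc : K b c ≠ 0 ∧ K c b ≠ 0) : K a c * K c a = 0 := by
  by_contra hac
  obtain ⟨kab, kba⟩ := edge_ne_zero h hp hp' hr hr'
  obtain ⟨kbc, kcb⟩ := hbc
  have hq := h.quad_add a b c d
  have eab := h.edge a b
  have eac := h.edge a c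
  have ebc := h.edge b c
  have ebd := h.edge b d
  obtain ⟨p1, p2⟩ := hp
  obtain ⟨r1, r2⟩ := hr
  obtain ⟨t1, t2⟩ := ht
  obtain ⟨u1, u2⟩ := hu
  simp only [flip] at r1 r2 u1 u2
  have c1 : (Q a b * Q b c * Q c d * Q d a) * (Q a c * Q c a) =
      (Q a b * Q b c * Q c a) * (Q a c * Q c d * Q d a) := by ring
  have c1' : (Q b a * Q c b * Q d c * Q a d) * (Q a c * Q c a) =
      (Q b a * Q c b * Q a c) * (Q c a * Q d c * Q a d) := by ring
  have c4 : (Q a b * Q b c * Q c d * Q d a) * (Q b d * Q d b) =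
      (Q a b * Q b d * Q d a) * (Q b c * Q c d * Q d b) := by ring
  have c3 : (Q a b * Q b d * Q d c * Q c a) * (Q b c * Q c b) =
      (Q a b * Q b c * Q c a) * (Q c b * Q d c * Q b d) := by ring
  have c3' : (Q b a * Q d b * Q c d * Q a c) * (Q b c * Q c b) =
      (Q b a * Q c b * Q a c) * (Q b c * Q c d * Q d b) := by ring
  have c2 : (Q a c * Q c b * Q b d * Q d a) * (Q a b * Q b a) =
      (Q b a * Q c b * Q a c) * (Q a b * Q b d * Q d a) := by ring
  have c2' : (Q c a * Q b c * Q d b * Q a d) * (Q a b * Q b a) =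
      (Q a b * Q b c * Q c a) * (Q b a * Q d b * Q a d) := by ring
  have u1' : K b c * K c d * K d b = Q c b * Q d c * Q b d := by rw [u1]
  have u2' : K c b * K d c * K b d = Q b c * Q c d * Q d b := by rw [u2]
  have r1' : K a b * K b d * K d a = Q b a * Q d b * Q a d := by rw [r1]
  have r2' : K b a * K d b * K a d = Q a b * Q b d * Q d a := by rw [r2]
  rw [← eac, ← p1, ← t1] at c1
  rw [← eac, ← p2, ← t2] at c1'
  rw [← ebd, ← r2', ← u2'] at c4
  rw [← ebc, ← p1, ← u1'] at c3
  rw [← ebc, ← p2, ← u2'] at c3'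
  rw [← eab, ← p1, ← r1'] at c2'
  rw [← eab, ← p2, ← r2'] at c2
  have d1 : K a b * K b c * K c d * K d a = Q a b * Q b c * Q c d * Q d a :=
    mul_right_cancel₀ hac (by linear_combination -c1)
  have d1' : K b a * K c b * K d c * K a d = Q b a * Q c b * Q d c * Q a d :=
    mul_right_cancel₀ hac (by linear_combination -c1')
  rw [← d1] at c4
  have hs : (K a b * K b c * K c a - K b a * K c b * K a c) *
      ((K a b * K b d * K d a - K b a * K d b * K a d) * (K b c * K c b) +
        (K b c * K c d * K d b - K c b * K d c * K b d) * (K a b * K b a)) = 0 := by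
    linear_combination (-K a b * K b a * K b c * K c b) * (hq - d1 - d1') -
      (K b c * K c b) * (c2 + c2') - (K a b * K b a) * (c3 + c3')
  have hs := (mul_eq_zero.1 hs).resolve_left (sub_ne_zero.2 hp')
  have f1 : (K a b * K b d * K d a - K b a * K d b * K a d) *
      (K b a * K d b * K a d * (K b c * K c b) - K b c * K c d * K d b * (K a b * K b a)) = 0 := by
    linear_combination (K b a * K d b * K a d) * hs - (K a b * K b a) * c4
  have f2 : (K a b * K b d * K d a - K b a * K d b * K a d) *
      (K a b * K b d * K d a * (K b c * K c b) - K c b * K d c * K b d * (K a b * K b a)) = 0 := by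
    linear_combination (K a b * K b d * K d a) * hs - (K a b * K b a) * c4
  have f1 := (mul_eq_zero.1 f1).resolve_left (sub_ne_zero.2 hr')
  have f2 := (mul_eq_zero.1 f2).resolve_left (sub_ne_zero.2 hr')
  have g1 : K d b = 0 := by
    have : (K b a * K b c) * (K a d * K c b - K a b * K c d) * K d b = 0 := by
      linear_combination f1
    have := (mul_eq_zero.1 this).resolve_left
      (mul_ne_zero (mul_ne_zero kba kbc) (hK a d b c nad nab nac nbd.symm ncd.symm nbc))
    exact this
  have g2 : K b d = 0 := by
    have : (K a b * K c b) * (K d a * K b c - K d c * K b a) * K b d = 0 := by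
      linear_combination f2
    exact (mul_eq_zero.1 this).resolve_left
      (mul_ne_zero (mul_ne_zero kab kcb) (hK d a c b nad.symm ncd.symm nbd.symm nac nab nbc.symm))
  exact hr' (by rw [g1, g2]; ring)

theorem false_of_diagonal_edges_eq_zero (h : DetEquiv K Q) (hK : ClassD K) {a b c d : Λ}
    (nab : a ≠ b) (nac : a ≠ c) (nad : a ≠ d) (nbc : b ≠ c) (nbd : b ≠ d) (ncd : c ≠ d)
    (hp : TriangleEq K Q a b c) (hp' : K a b * K b c * K c a ≠ K b a * K c b * K a c)
    (hr : TriangleEq K (flip Q) a b d) (hr' : K a b * K b d * K d a ≠ K b a * K d b * K a d)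
    (ht : TriangleEq K Q a c d) (ht' : K a c * K c d * K d a ≠ K c a * K d c * K a d)
    (hu : TriangleEq K (flip Q) b c d)
    (hac : K a c = 0) (hbd : K b d = 0) : False := by
  have hq := h.quad_add a b c d
  have eab := h.edge a b
  have eac := h.edge a c
  have ead := h.edge a d
  have ebc := h.edge b c
  have ebd := h.edge b d
  have ecd := h.edge c d
  have nz := hK b c a d nbc nab.symm nbd nac.symm ncd nad
  obtain ⟨p1, p2⟩ := hp
  obtain ⟨r1, r2⟩ := hr
  obtain ⟨t1, t2⟩ := ht
  obtain ⟨u1, u2⟩ := hu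
  simp only [flip] at r1 r2 u1 u2
  have kp : K a b * K b c * K c a ≠ 0 := by grind
  have kr : K b a * K d b * K a d ≠ 0 := by grind
  have kt : K c a * K d c * K a d ≠ 0 := by grind
  have qac : Q a c = 0 := by grind
  have qdb : Q d b = 0 := by grind
  have c1 : (Q a b * Q b c * Q c d * Q d a) * (Q c a * Q d c * Q a d) =
      (Q a b * Q b c * Q c a) * (Q c d * Q d c) * (Q a d * Q d a) := by ring
  have c1' : (Q b a * Q c b * Q d c * Q a d) * (Q a b * Q b c * Q c a) =
      (Q c a * Q d c * Q a d) * (Q a b * Q b a) * (Q b c * Q c b) := by ring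
  have c3 : (Q a b * Q b d * Q d c * Q c a) * (Q a d * Q d a) =
      (Q a b * Q b d * Q d a) * (Q c a * Q d c * Q a d) := by ring
  have r2' : K b a * K d b * K a d = Q a b * Q b d * Q d a := by rw [r2]
  rw [← p1, ← t2, ← ecd, ← ead] at c1
  rw [← p1, ← t2, ← eab, ← ebc] at c1'
  rw [← r2', ← t2, ← ead] at c3
  have d1 : K a b * K b c * K c d * K d a = Q a b * Q b c * Q c d * Q d a :=
    mul_right_cancel₀ kt (by linear_combination -c1)
  have d1' : K b a * K c b * K d c * K a d = Q b a * Q c b * Q d c * Q a d :=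
    mul_right_cancel₀ kp (by linear_combination -c1')
  have e : K c a * K b c * K d b * K a d = Q a b * Q b d * Q d c * Q c a := by
    simp only [hac, hbd, qac, qdb] at hq
    linear_combination hq - d1 - d1'
  rw [← e] at c3
  have : (K c a * K d b * K a d * K a d) * (K b c * K d a - K b a * K d c) = 0 := by
    linear_combination c3
  grind

theorem false_of_crossed_diagonal_edges_eq_zero (h : DetEquiv K Q) (hQ : ClassD Q) {a b c d : Λ}
    (nab : a ≠ b) (nac : a ≠ c) (nad : a ≠ d) (nbc : b ≠ c) (nbd : b ≠ d) (ncd : c ≠ d)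
    (hp : TriangleEq K Q a b c) (hp' : K a b * K b c * K c a ≠ K b a * K c b * K a c)
    (hr : TriangleEq K (flip Q) a b d) (hr' : K a b * K b d * K d a ≠ K b a * K d b * K a d)
    (ht : TriangleEq K Q a c d) (ht' : K a c * K c d * K d a ≠ K c a * K d c * K a d)
    (hu : TriangleEq K (flip Q) b c d)
    (hac : K a c = 0) (hdb : K d b = 0) : False := by
  have eac := h.edge a c
  have ebd := h.edge b d
  obtain ⟨p1, p2⟩ := hp
  obtain ⟨r1, r2⟩ := hr
  obtain ⟨t1, t2⟩ := ht
  obtain ⟨u1, u2⟩ := hu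
  simp only [flip] at r1 r2 u1 u2
  have qac : Q a c = 0 := by grind
  have qbd : Q b d = 0 := by grind
  exact false_of_diagonal_edges_eq_zero h.symm hQ nab nac nad nbc nbd ncd ⟨p1.symm, p2.symm⟩
    (by rwa [← p1, ← p2]) ⟨r2.symm, r1.symm⟩ (by rw [← r1, ← r2]; exact hr'.symm)
    ⟨t1.symm, t2.symm⟩ (by rwa [← t1, ← t2]) ⟨u2.symm, u1.symm⟩ qac qbd

theorem not_same_flip (h : DetEquiv K Q) (hK : ClassD K) (hQ : ClassD Q) {a b c d : Λ}
    (nab : a ≠ b) (nac : a ≠ c) (nad : a ≠ d) (nbc : b ≠ c) (nbd : b ≠ d) (ncd : c ≠ d)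
    (hp : TriangleEq K Q a b c) (hp' : K a b * K b c * K c a ≠ K b a * K c b * K a c)
    (hr : TriangleEq K (flip Q) a b d) (hr' : K a b * K b d * K d a ≠ K b a * K d b * K a d)
    (ht : TriangleEq K Q a c d) (ht' : K a c * K c d * K d a ≠ K c a * K d c * K a d)
    (hu : TriangleEq K (flip Q) b c d) (hu' : K b c * K c d * K d b ≠ K c b * K d c * K b d) :
    False := by
  have hf : DetEquiv (flip K) (flip Q) := h.symm.flip_right.symm.flip_right
  have hbc : K b c ≠ 0 ∧ K c b ≠ 0 := by
    refine edge_ne_zero h (d := d) (a := b) (b := c) (c := a) ?_ ?_ hu hu'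
    · exact hp.rotate
    · grind
  have had : K a d ≠ 0 ∧ K d a ≠ 0 := by
    refine edge_ne_zero h.flip_right (d := c) (a := a) (b := d) (c := b) ?_ ?_ ?_ ?_
    · exact hr.swap.rotate
    · grind
    · exact ht.rotate.swap.rotate.rotate
    · grind
  have hac := edge_eq_zero_of_same_flip h hK nab nac nad nbc nbd ncd hp hp' hr hr' ht hu hbc
  have hbd : K b d * K d b = 0 :=
    edge_eq_zero_of_same_flip h.flip_right hK nab.symm nbd nbc nad nac ncd.symm
      hr.swap (by grind) hp.swap (by grind) hu.swap_right ht.swap_right had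
  rcases mul_eq_zero.1 hac with hac | hac <;> rcases mul_eq_zero.1 hbd with hbd | hbd
  · exact false_of_diagonal_edges_eq_zero h hK nab nac nad nbc nbd ncd hp hp' hr hr' ht ht' hu hac hbd
  · exact false_of_crossed_diagonal_edges_eq_zero h hQ nab nac nad nbc nbd ncd hp hp' hr hr' ht ht' hu
      hac hbd
  · exact false_of_crossed_diagonal_edges_eq_zero hf hQ.flip nab nac nad nbc nbd ncd hp.symm hp'.symm
      hr.symm hr'.symm ht.symm ht'.symm hu.symm hac hbd
  · exact false_of_diagonal_edges_eq_zero hf hK.flip nab nac nad nbc nbd ncd hp.symm hp'.symm hr.symm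
      hr'.symm ht.symm ht'.symm hu.symm hac hbd

theorem not_adjacent_mismatch (h : DetEquiv K Q) (hK : ClassD K) (hQ : ClassD Q) {a b c d : Λ}
    (nab : a ≠ b) (nac : a ≠ c) (nad : a ≠ d) (nbc : b ≠ c) (nbd : b ≠ d) (ncd : c ≠ d)
    (hp : ¬ TriangleEq K (flip Q) a b c) (hr : ¬ TriangleEq K Q a b d) : False := by
  have strict {Q' : Λ → Λ → F} {x y z : Λ} (hn : ¬ TriangleEq K (flip Q') x y z)
      (hs : TriangleEq K Q' x y z) : K x y * K y z * K z x ≠ K y x * K z y * K x z :=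
    fun he => hn ⟨he.trans hs.2, he.symm.trans hs.1⟩
  have hp1 := (h.triangleEq_or a b c).resolve_right hp
  have hr1 := (h.triangleEq_or a b d).resolve_left hr
  have hp' := strict hp hp1
  have hr' := strict hr hr1
  by_cases ht : TriangleEq K Q a c d <;> by_cases hu : TriangleEq K Q b c d
  · exact not_same_same h hK hQ nab nac nad nbc nbd ncd hp1 hp' hr1 hr' ht hu
  · have hu1 := (h.triangleEq_or b c d).resolve_left hu
    by_cases ht2 : TriangleEq K (flip Q) a c d
    · exact not_same_same h.flip_right hK hQ.flip nab nad nac nbd nbc ncd.symm hr1 hr' hp1 hp'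
        ht2.swap_right hu1.swap_right
    · exact not_same_flip h hK hQ nab nac nad nbc nbd ncd hp1 hp' hr1 hr' ht (strict ht2 ht) hu1
        (strict hu hu1)
  · have ht1 := (h.triangleEq_or a c d).resolve_left ht
    by_cases hu2 : TriangleEq K (flip Q) b c d
    · exact not_same_same h.flip_right hK hQ.flip nab nad nac nbd nbc ncd.symm hr1 hr' hp1 hp'
        ht1.swap_right hu2.swap_right
    · exact not_same_flip h hK hQ nab.symm nbc nbd nac nad ncd hp1.swap (by grind) hr1.swap
        (by grind) hu (strict hu2 hu) ht1 (strict ht ht1)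
  · exact not_same_same h.flip_right hK hQ.flip nab nad nac nbd nbc ncd.symm hr1 hr' hp1 hp'
      ((h.triangleEq_or a c d).resolve_left ht).swap_right
      ((h.triangleEq_or b c d).resolve_left hu).swap_right

end

theorem stmt18 {Λ F : Type*} [Field F] (hcard : 4 ≤ Cardinal.mk Λ)
    (K Q : Λ → Λ → F) (hKQ : DetEquiv K Q) (hK : ClassD K) (hQ : ClassD Q) :
    ∀ M : Finset Λ, M.card = 4 →
      ((∀ a b c : Λ, a ∈ M → b ∈ M → c ∈ M → a ≠ b → a ≠ c → b ≠ c →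
          K a b * K b c * K c a = Q a b * Q b c * Q c a ∧
          K b a * K c b * K a c = Q b a * Q c b * Q a c) ∨
       (∀ a b c : Λ, a ∈ M → b ∈ M → c ∈ M → a ≠ b → a ≠ c → b ≠ c →
          K a b * K b c * K c a = Q b a * Q c b * Q a c ∧
          K b a * K c b * K a c = Q a b * Q b c * Q c a)) := by
  intro M hM
  rw [or_iff_not_imp_right]
  intro h2 a b c ha hb hc hab hac hbc
  push Not at h2
  obtain ⟨x, y, z, hx, hy, hz, hxy, hxz, hyz, hn⟩ := h2
  have hp : ¬ TriangleEq K (flip Q) x y z := fun h => hn h.1 h.2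
  have hs := (hKQ.triangleEq_or x y z).resolve_right hp
  obtain ⟨w, hw, hwx, hwy, hwz⟩ : ∃ w ∈ M, w ≠ x ∧ w ≠ y ∧ w ≠ z := by
    classical
    obtain ⟨w, hw, hw'⟩ := Finset.exists_mem_notMem_of_card_lt_card (s := {x, y, z}) (t := M)
      (by rw [hM]; exact Finset.card_le_three.trans_lt (by norm_num))
    exact ⟨w, hw, by simpa using hw'⟩
  have hM' : ∀ v ∈ M, v = x ∨ v = y ∨ v = z ∨ v = w := by
    classical
    have h4 : ({x, y, z, w} : Finset Λ) = M := by
      apply Finset.eq_of_subset_of_card_le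
      · simp [Finset.insert_subset_iff, *]
      · rw [hM, Finset.card_eq_four.2 ⟨x, y, z, w, hxy, hxz, hwx.symm, hyz, hwy.symm,
          hwz.symm, rfl⟩]
    intro v hv
    simpa [← h4] using hv
  have hxyw : TriangleEq K Q x y w := by
    by_contra hr
    exact not_adjacent_mismatch hKQ hK hQ hxy hxz hwx.symm hyz hwy.symm hwz.symm hp hr
  have hyzw : TriangleEq K Q y z w := by
    by_contra hr
    exact not_adjacent_mismatch hKQ hK hQ hyz hxy.symm hwy.symm hxz.symm hwz.symm hwx.symm
      (fun h => hp h.rotate.rotate) hr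
  have hzxw : TriangleEq K Q z x w := by
    by_contra hr
    exact not_adjacent_mismatch hKQ hK hQ hxz.symm hyz.symm hwz.symm hxy hwx.symm hwy.symm
      (fun h => hp h.rotate) hr
  have rot {u v t : Λ} : TriangleEq K Q u v t → TriangleEq K Q v t u := TriangleEq.rotate
  have sw {u v t : Λ} : TriangleEq K Q u v t → TriangleEq K Q v u t := TriangleEq.swap
  change TriangleEq K Q a b c
  grind
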